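/- Completeness of the Gr(K_{R⁻¹∩})-algorithm: if a Gr(K_{R⁻¹∩})-formula φ in NNF is satisfiable, then there exists a sequence of applications of the Gr(K_{R⁻¹∩}) completion rules starting with {x₀ ⊨ φ} that results in a complete and clash-free constraint system. -/

import Mathlib

/-! Core definitions for the graded modal logic Gr(K_R):
syntax, Kripke semantics, NNF, closure, constraint systems,
and the completion rules (optimised and standard). -/

namespace GrK

/-- Gr(K_R)-formulae over propositional atoms (ℕ) and relation names (ℕ).
`ge r n φ` is the counting modality ⟨R⟩_{≥n}φ and `le r n φ` is ⟨R⟩_{≤n}φ. -/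
inductive GFormula : Type where
  | atom : ℕ → GFormula
  | neg  : GFormula → GFormula
  | and  : GFormula → GFormula → GFormula
  | or   : GFormula → GFormula → GFormula
  | ge   : ℕ → ℕ → GFormula → GFormula
  | le   : ℕ → ℕ → GFormula → GFormula
  deriving DecidableEq

/-- A Kripke structure: a nonempty type of worlds, an accessibility relation
for each relation name, and a valuation. -/
structure Kripke where
  W : Type
  nonempty : Nonempty W
  rel : ℕ → W → W → Prop
  val : ℕ → Set W

/-- Satisfaction `M, x ⊨ φ`; the graded modalities count successors
(as a cardinal, to handle infinite structures faithfully). -/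
def GFormula.sat (M : Kripke) : GFormula → M.W → Prop
  | .atom p, x => x ∈ M.val p
  | .neg φ, x => ¬ GFormula.sat M φ x
  | .and φ ψ, x => GFormula.sat M φ x ∧ GFormula.sat M ψ x
  | .or φ ψ, x => GFormula.sat M φ x ∨ GFormula.sat M ψ x
  | .ge r n φ, x => (n : Cardinal) ≤ Cardinal.mk {y : M.W // M.rel r x y ∧ GFormula.sat M φ y}
  | .le r n φ, x => Cardinal.mk {y : M.W // M.rel r x y ∧ GFormula.sat M φ y} ≤ (n : Cardinal)

/-- ♯R^M(x,φ): the number of R-successors of x satisfying φ. -/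
def Kripke.count (M : Kripke) (r : ℕ) (x : M.W) (φ : GFormula) : Cardinal :=
  Cardinal.mk {y : M.W // M.rel r x y ∧ GFormula.sat M φ y}

/-- A formula is satisfiable iff it holds at some world of some Kripke structure. -/
def GFormula.satisfiable (φ : GFormula) : Prop :=
  ∃ (M : Kripke) (x : M.W), GFormula.sat M φ x

/-- Negation normal form: negation occurs only in front of atoms. -/
def GFormula.isNNF : GFormula → Prop
  | .atom _ => True
  | .neg (.atom _) => True
  | .neg _ => False
  | .and φ ψ => GFormula.isNNF φ ∧ GFormula.isNNF ψ
  | .or φ ψ => GFormula.isNNF φ ∧ GFormula.isNNF ψ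
  | .ge _ _ φ => GFormula.isNNF φ
  | .le _ _ φ => GFormula.isNNF φ

/-- ~φ : the NNF of the negation of an NNF formula. -/
def GFormula.nnfNeg : GFormula → GFormula
  | .atom p => .neg (.atom p)
  | .neg φ => φ
  | .and φ ψ => .or φ.nnfNeg ψ.nnfNeg
  | .or φ ψ => .and φ.nnfNeg ψ.nnfNeg
  | .ge r n φ => if n = 0 then .and (.atom 0) (.neg (.atom 0)) else .le r (n - 1) φ
  | .le r n φ => .ge r (n + 1) φ

/-- |φ| : the length of a formula. -/
def GFormula.size : GFormula → ℕ
  | .atom _ => 1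
  | .neg φ => 1 + φ.size
  | .and φ ψ => 1 + φ.size + ψ.size
  | .or φ ψ => 1 + φ.size + ψ.size
  | .ge _ _ φ => 1 + φ.size
  | .le _ _ φ => 1 + φ.size

/-- sub(φ) : the set of subformulae of φ. -/
def GFormula.sub : GFormula → Finset GFormula
  | .atom p => {.atom p}
  | .neg φ => insert (.neg φ) φ.sub
  | .and φ ψ => insert (.and φ ψ) (φ.sub ∪ ψ.sub)
  | .or φ ψ => insert (.or φ ψ) (φ.sub ∪ ψ.sub)
  | .ge r n φ => insert (.ge r n φ) φ.sub
  | .le r n φ => insert (.le r n φ) φ.sub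

/-- Membership in clos(φ): the smallest set containing φ, closed under
immediate subformulae of ∧, ∨ and the graded modalities, and closed under ~. -/
inductive InClos (φ : GFormula) : GFormula → Prop
  | base : InClos φ φ
  | andL {ψ₁ ψ₂} : InClos φ (.and ψ₁ ψ₂) → InClos φ ψ₁
  | andR {ψ₁ ψ₂} : InClos φ (.and ψ₁ ψ₂) → InClos φ ψ₂
  | orL {ψ₁ ψ₂} : InClos φ (.or ψ₁ ψ₂) → InClos φ ψ₁
  | orR {ψ₁ ψ₂} : InClos φ (.or ψ₁ ψ₂) → InClos φ ψ₂
  | ge {r n ψ} : InClos φ (.ge r n ψ) → InClos φ ψ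
  | le {r n ψ} : InClos φ (.le r n ψ) → InClos φ ψ
  | nnfNeg {ψ} : InClos φ ψ → InClos φ ψ.nnfNeg

/-- clos(φ) as a set of formulae. -/
def clos (φ : GFormula) : Set GFormula := {ψ | InClos φ ψ}

/-- A constraint: either `x ⊨ ψ` or `R x y`;
a constraint system (c.s.) is a finite set of constraints. -/
inductive Constraint : Type where
  | sat : ℕ → GFormula → Constraint
  | rel : ℕ → ℕ → ℕ → Constraint
  deriving DecidableEq

/-- The variables occurring in a constraint. -/
def Constraint.vars : Constraint → Finset ℕ
  | .sat x _ => {x}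
  | .rel _ x y => {x, y}

/-- ♯R^S(x,ψ): the number of variables y with {Rxy, y ⊨ ψ} ⊆ S. -/
noncomputable def countS (S : Finset Constraint) (r x : ℕ) (ψ : GFormula) : ℕ :=
  Set.ncard {y : ℕ | Constraint.rel r x y ∈ S ∧ Constraint.sat y ψ ∈ S}

/-- A clash: {x ⊨ p, x ⊨ ¬p} ⊆ S, or x ⊨ ⟨R⟩_{≤n}ψ ∈ S with ♯R^S(x,ψ) > n. -/
def hasClash (S : Finset Constraint) : Prop :=
  (∃ x p, Constraint.sat x (.atom p) ∈ S ∧ Constraint.sat x (.neg (.atom p)) ∈ S) ∨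
  (∃ x r n ψ, Constraint.sat x (.le r n ψ) ∈ S ∧ n < countS S r x ψ)

/-- `y` is a fresh variable w.r.t. S. -/
def freshIn (y : ℕ) (S : Finset Constraint) : Prop := ∀ c ∈ S, y ∉ c.vars

/-- The →∧-rule is applicable to a constraint for x in S. -/
def andApplicable (S : Finset Constraint) (x : ℕ) : Prop :=
  ∃ ψ₁ ψ₂, Constraint.sat x (.and ψ₁ ψ₂) ∈ S ∧
    ¬ (Constraint.sat x ψ₁ ∈ S ∧ Constraint.sat x ψ₂ ∈ S)

/-- The →∨-rule is applicable to a constraint for x in S. -/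
def orApplicable (S : Finset Constraint) (x : ℕ) : Prop :=
  ∃ ψ₁ ψ₂, Constraint.sat x (.or ψ₁ ψ₂) ∈ S ∧
    Constraint.sat x ψ₁ ∉ S ∧ Constraint.sat x ψ₂ ∉ S

/-- One application of the →∧-rule. -/
inductive StepAnd : Finset Constraint → Finset Constraint → Prop
  | mk (S : Finset Constraint) (x : ℕ) (ψ₁ ψ₂ : GFormula)
      (h : Constraint.sat x (.and ψ₁ ψ₂) ∈ S)
      (h2 : ¬ (Constraint.sat x ψ₁ ∈ S ∧ Constraint.sat x ψ₂ ∈ S)) :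
      StepAnd S (insert (Constraint.sat x ψ₁) (insert (Constraint.sat x ψ₂) S))

/-- One application of the →∨-rule. -/
inductive StepOr : Finset Constraint → Finset Constraint → Prop
  | mk (S : Finset Constraint) (x : ℕ) (ψ₁ ψ₂ χ : GFormula)
      (h : Constraint.sat x (.or ψ₁ ψ₂) ∈ S)
      (h1 : Constraint.sat x ψ₁ ∉ S) (h2 : Constraint.sat x ψ₂ ∉ S)
      (hχ : χ = ψ₁ ∨ χ = ψ₂) :
      StepOr S (insert (Constraint.sat x χ) S)

/-- One application of the optimised →≥-rule: if x ⊨ ⟨R⟩_{≥n}ψ ∈ S,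
♯R^S(x,ψ) < n and no →∧/→∨ rule applies to a constraint for x, add (for a
fresh y) the constraints Rxy, y ⊨ ψ, and y ⊨ χᵢ with χᵢ ∈ {ψᵢ, ~ψᵢ} for every
ψᵢ occurring in a graded constraint ⟨R⟩_{⋈m}ψᵢ for x with the same relation R. -/
inductive StepGe : Finset Constraint → Finset Constraint → Prop
  | mk (S S' : Finset Constraint) (x r n : ℕ) (ψ : GFormula) (y : ℕ)
      (f : GFormula → GFormula)
      (h : Constraint.sat x (.ge r n ψ) ∈ S)
      (hc : countS S r x ψ < n)
      (hna : ¬ andApplicable S x) (hno : ¬ orApplicable S x)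
      (hy : freshIn y S)
      (hf : ∀ ψ', f ψ' = ψ' ∨ f ψ' = ψ'.nnfNeg)
      (hS' : (S' : Set Constraint) = (S : Set Constraint) ∪
          {Constraint.rel r x y, Constraint.sat y ψ} ∪
          {c | ∃ ψ' m,
            (Constraint.sat x (.ge r m ψ') ∈ S ∨ Constraint.sat x (.le r m ψ') ∈ S) ∧
            c = Constraint.sat y (f ψ')}) :
      StepGe S S'

/-- One application of any optimised completion rule. -/
def OptStep (S S' : Finset Constraint) : Prop := StepAnd S S' ∨ StepOr S S' ∨ StepGe S S'

/-- The initial constraint system {x₀ ⊨ φ}. -/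
def initCS (x₀ : ℕ) (φ : GFormula) : Finset Constraint := {Constraint.sat x₀ φ}

/-- S is obtained from {x₀ ⊨ φ} by a sequence of optimised rule applications. -/
def OptReach (x₀ : ℕ) (φ : GFormula) (S : Finset Constraint) : Prop :=
  Relation.ReflTransGen OptStep (initCS x₀ φ) S

/-- A c.s. is complete iff no optimised rule is applicable. -/
def OptComplete (S : Finset Constraint) : Prop := ¬ ∃ S', OptStep S S'

/-- The edges of the graph G(S) induced by a c.s. S. -/
def edge (S : Finset Constraint) (x y : ℕ) : Prop := ∃ r, Constraint.rel r x y ∈ S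

/-- The variable x occurs in S (x is a node of G(S)). -/
def occursIn (x : ℕ) (S : Finset Constraint) : Prop := ∃ c ∈ S, x ∈ c.vars

/-- Satisfiability of a constraint system. -/
def csSat (S : Finset Constraint) : Prop :=
  ∃ (M : Kripke) (α : ℕ → M.W),
    (∀ r x y z, Constraint.rel r x y ∈ S → Constraint.rel r x z ∈ S → y ≠ z → α y ≠ α z) ∧
    (∀ x ψ, Constraint.sat x ψ ∈ S → GFormula.sat M ψ (α x)) ∧
    (∀ r x y, Constraint.rel r x y ∈ S → M.rel r (α x) (α y))

/-- The canonical structure M_S induced by a c.s. S (on the variables,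
with accessibility and valuation read off from S). -/
def canonical (S : Finset Constraint) : Kripke where
  W := ℕ
  nonempty := ⟨0⟩
  rel := fun r x y => Constraint.rel r x y ∈ S
  val := fun p => {x | Constraint.sat x (.atom p) ∈ S}

/-- Renaming a variable: `rename y z c` replaces y by z in the constraint c. -/
def Constraint.rename (y z : ℕ) : Constraint → Constraint
  | .sat x ψ => .sat (if x = y then z else x) ψ
  | .rel r a b => .rel r (if a = y then z else a) (if b = y then z else b)

/-- [z/y]S : replace every occurrence of y by z in S. -/
def renameCS (S : Finset Constraint) (y z : ℕ) : Finset Constraint :=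
  S.image (Constraint.rename y z)

/-- The replacement of y by z in S is safe. -/
def safeReplace (S : Finset Constraint) (y z : ℕ) : Prop :=
  ∀ x r n ψ, Constraint.sat x (.ge r n ψ) ∈ S → Constraint.rel r x y ∈ S →
    Constraint.rel r x z ∈ S → n ≤ countS (renameCS S y z) r x ψ

/-- One application of a standard (Hollunder–Baader) completion rule. -/
inductive StdStep : Finset Constraint → Finset Constraint → Prop
  | and (S : Finset Constraint) (x : ℕ) (ψ₁ ψ₂ : GFormula)
      (h : Constraint.sat x (.and ψ₁ ψ₂) ∈ S)
      (h2 : ¬ (Constraint.sat x ψ₁ ∈ S ∧ Constraint.sat x ψ₂ ∈ S)) :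
      StdStep S (insert (Constraint.sat x ψ₁) (insert (Constraint.sat x ψ₂) S))
  | or (S : Finset Constraint) (x : ℕ) (ψ₁ ψ₂ χ : GFormula)
      (h : Constraint.sat x (.or ψ₁ ψ₂) ∈ S)
      (h1 : Constraint.sat x ψ₁ ∉ S) (h2 : Constraint.sat x ψ₂ ∉ S)
      (hχ : χ = ψ₁ ∨ χ = ψ₂) :
      StdStep S (insert (Constraint.sat x χ) S)
  | choose (S : Finset Constraint) (x r n : ℕ) (ψ χ : GFormula) (y : ℕ)
      (h : Constraint.sat x (.ge r n ψ) ∈ S ∨ Constraint.sat x (.le r n ψ) ∈ S)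
      (hr : Constraint.rel r x y ∈ S)
      (h1 : Constraint.sat y ψ ∉ S) (h2 : Constraint.sat y ψ.nnfNeg ∉ S)
      (hχ : χ = ψ ∨ χ = ψ.nnfNeg) :
      StdStep S (insert (Constraint.sat y χ) S)
  | ge (S : Finset Constraint) (x r n : ℕ) (ψ : GFormula) (y : ℕ)
      (h : Constraint.sat x (.ge r n ψ) ∈ S)
      (hc : countS S r x ψ < n)
      (hy : freshIn y S) :
      StdStep S (insert (Constraint.rel r x y) (insert (Constraint.sat y ψ) S))
  | le (S : Finset Constraint) (x r n : ℕ) (ψ : GFormula) (y z : ℕ)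
      (h : Constraint.sat x (.le r n ψ) ∈ S)
      (hc : n < countS S r x ψ)
      (hyz : y ≠ z)
      (h1 : Constraint.rel r x y ∈ S) (h2 : Constraint.rel r x z ∈ S)
      (h3 : Constraint.sat y ψ ∈ S) (h4 : Constraint.sat z ψ ∈ S)
      (hsafe : safeReplace S y z) :
      StdStep S (renameCS S y z)

/-- S is obtained from {x₀ ⊨ φ} by a sequence of standard rule applications. -/
def StdReach (x₀ : ℕ) (φ : GFormula) (S : Finset Constraint) : Prop :=
  Relation.ReflTransGen StdStep (initCS x₀ φ) S

/-- A c.s. is complete (for the standard rules) iff no rule is applicable. -/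
def StdComplete (S : Finset Constraint) : Prop := ¬ ∃ S', StdStep S S'

end GrK

/-! Core definitions for Gr(K_{R⁻¹∩}): relations with inverses,
intersections of relations, formulae, semantics, constraint systems with
the ≺ bookkeeping relation, and the Gr(K_{R⁻¹∩}) completion rules. -/

namespace GrK

/-- A Gr(K_{R⁻¹∩})-relation: a relation name or the inverse of one. -/
inductive GRel : Type where
  | name : ℕ → GRel
  | inv : ℕ → GRel
  deriving DecidableEq

/-- The inverse of a Gr(K_{R⁻¹∩})-relation, with (R⁻¹)⁻¹ = R. -/
def GRel.inverse : GRel → GRel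
  | .name r => .inv r
  | .inv r => .name r

/-- A (nonempty) intersection ω = R₁ ∩ … ∩ R_k of Gr(K_{R⁻¹∩})-relations. -/
abbrev RelInter := {ω : Finset GRel // ω.Nonempty}

/-- Gr(K_{R⁻¹∩})-formulae: graded modalities over intersections of
(possibly inverse) relations. -/
inductive GIFormula : Type where
  | atom : ℕ → GIFormula
  | neg  : GIFormula → GIFormula
  | and  : GIFormula → GIFormula → GIFormula
  | or   : GIFormula → GIFormula → GIFormula
  | ge   : RelInter → ℕ → GIFormula → GIFormula
  | le   : RelInter → ℕ → GIFormula → GIFormula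

noncomputable instance : DecidableEq GIFormula := Classical.decEq _

/-- Interpretation of a (possibly inverse) relation in a Kripke structure. -/
def GRel.interp (M : Kripke) : GRel → M.W → M.W → Prop
  | .name r => M.rel r
  | .inv r => fun x y => M.rel r y x

/-- Satisfaction for Gr(K_{R⁻¹∩}): ⟨ω⟩_{≥n}/⟨ω⟩_{≤n} count the
⋂_{R∈ω}R-successors satisfying the formula. -/
def GIFormula.sat (M : Kripke) : GIFormula → M.W → Prop
  | .atom p, x => x ∈ M.val p
  | .neg φ, x => ¬ GIFormula.sat M φ x
  | .and φ ψ, x => GIFormula.sat M φ x ∧ GIFormula.sat M ψ x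
  | .or φ ψ, x => GIFormula.sat M φ x ∨ GIFormula.sat M ψ x
  | .ge ω n φ, x => (n : Cardinal) ≤
      Cardinal.mk {y : M.W // (∀ R ∈ ω.1, GRel.interp M R x y) ∧ GIFormula.sat M φ y}
  | .le ω n φ, x =>
      Cardinal.mk {y : M.W // (∀ R ∈ ω.1, GRel.interp M R x y) ∧ GIFormula.sat M φ y} ≤
        (n : Cardinal)

/-- Satisfiability of a Gr(K_{R⁻¹∩})-formula. -/
def GIFormula.satisfiable (φ : GIFormula) : Prop :=
  ∃ (M : Kripke) (x : M.W), GIFormula.sat M φ x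

/-- Negation normal form for Gr(K_{R⁻¹∩}). -/
def GIFormula.isNNF : GIFormula → Prop
  | .atom _ => True
  | .neg (.atom _) => True
  | .neg _ => False
  | .and φ ψ => GIFormula.isNNF φ ∧ GIFormula.isNNF ψ
  | .or φ ψ => GIFormula.isNNF φ ∧ GIFormula.isNNF ψ
  | .ge _ _ φ => GIFormula.isNNF φ
  | .le _ _ φ => GIFormula.isNNF φ

/-- ~φ for Gr(K_{R⁻¹∩})-formulae in NNF. -/
def GIFormula.nnfNeg : GIFormula → GIFormula
  | .atom p => .neg (.atom p)
  | .neg φ => φ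
  | .and φ ψ => .or φ.nnfNeg ψ.nnfNeg
  | .or φ ψ => .and φ.nnfNeg ψ.nnfNeg
  | .ge ω n φ => if n = 0 then .and (.atom 0) (.neg (.atom 0)) else .le ω (n - 1) φ
  | .le ω n φ => .ge ω (n + 1) φ

/-- Constraints for Gr(K_{R⁻¹∩}): `x ⊨ ψ` or `R x y` for a
(possibly inverse) relation R. -/
inductive IConstraint : Type where
  | sat : ℕ → GIFormula → IConstraint
  | rel : GRel → ℕ → ℕ → IConstraint

noncomputable instance : DecidableEq IConstraint := Classical.decEq _

/-- Variables occurring in a constraint. -/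
def IConstraint.vars : IConstraint → Finset ℕ
  | .sat x _ => {x}
  | .rel _ x y => {x, y}

/-- ♯ω^S(x,ψ): the number of variables y with Rxy ∈ S for all R ∈ ω
and y ⊨ ψ ∈ S. -/
noncomputable def countI (S : Finset IConstraint) (ω : RelInter) (x : ℕ) (ψ : GIFormula) : ℕ :=
  Set.ncard {y : ℕ | (∀ R ∈ ω.1, IConstraint.rel R x y ∈ S) ∧ IConstraint.sat y ψ ∈ S}

/-- A clash for Gr(K_{R⁻¹∩}). -/
def hasClashI (S : Finset IConstraint) : Prop :=
  (∃ x p, IConstraint.sat x (.atom p) ∈ S ∧ IConstraint.sat x (.neg (.atom p)) ∈ S) ∨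
  (∃ x ω n ψ, IConstraint.sat x (.le ω n ψ) ∈ S ∧ n < countI S ω x ψ)

/-- The state of the Gr(K_{R⁻¹∩})-algorithm: a constraint system together with
the bookkeeping relation ≺ (x ≺ y iff y was created by the →≥-rule for x). -/
structure IState where
  cs : Finset IConstraint
  prec : Finset (ℕ × ℕ)

/-- The relation ≺ given by the bookkeeping finset. -/
def precRel (P : Finset (ℕ × ℕ)) : ℕ → ℕ → Prop := fun a b => (a, b) ∈ P

/-- The →∧-rule applies to a constraint for x. -/
def iAndApplicable (S : Finset IConstraint) (x : ℕ) : Prop :=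
  ∃ ψ₁ ψ₂, IConstraint.sat x (.and ψ₁ ψ₂) ∈ S ∧
    ¬ (IConstraint.sat x ψ₁ ∈ S ∧ IConstraint.sat x ψ₂ ∈ S)

/-- The →∨-rule applies to a constraint for x. -/
def iOrApplicable (S : Finset IConstraint) (x : ℕ) : Prop :=
  ∃ ψ₁ ψ₂, IConstraint.sat x (.or ψ₁ ψ₂) ∈ S ∧
    IConstraint.sat x ψ₁ ∉ S ∧ IConstraint.sat x ψ₂ ∉ S

/-- The →choose-rule applies to a constraint for x. -/
def iChooseApplicable (S : Finset IConstraint) (x : ℕ) : Prop :=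
  ∃ ω n ψ y, (IConstraint.sat x (.ge ω n ψ) ∈ S ∨ IConstraint.sat x (.le ω n ψ) ∈ S) ∧
    (∃ R ∈ ω.1, IConstraint.rel R x y ∈ S) ∧
    IConstraint.sat y ψ ∉ S ∧ IConstraint.sat y ψ.nnfNeg ∉ S

/-- One application of a Gr(K_{R⁻¹∩}) completion rule. -/
inductive IStep : IState → IState → Prop
  | and (st : IState) (x : ℕ) (ψ₁ ψ₂ : GIFormula)
      (h : IConstraint.sat x (.and ψ₁ ψ₂) ∈ st.cs)
      (h2 : ¬ (IConstraint.sat x ψ₁ ∈ st.cs ∧ IConstraint.sat x ψ₂ ∈ st.cs)) :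
      IStep st ⟨insert (IConstraint.sat x ψ₁) (insert (IConstraint.sat x ψ₂) st.cs), st.prec⟩
  | or (st : IState) (x : ℕ) (ψ₁ ψ₂ χ : GIFormula)
      (h : IConstraint.sat x (.or ψ₁ ψ₂) ∈ st.cs)
      (h1 : IConstraint.sat x ψ₁ ∉ st.cs) (h2 : IConstraint.sat x ψ₂ ∉ st.cs)
      (hχ : χ = ψ₁ ∨ χ = ψ₂) :
      IStep st ⟨insert (IConstraint.sat x χ) st.cs, st.prec⟩
  | choose (st : IState) (S' : Finset IConstraint) (P' : Finset (ℕ × ℕ))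
      (x : ℕ) (ω : RelInter) (n : ℕ) (ψ χ : GIFormula) (y : ℕ)
      (h : IConstraint.sat x (.ge ω n ψ) ∈ st.cs ∨ IConstraint.sat x (.le ω n ψ) ∈ st.cs)
      (hr : ∃ R ∈ ω.1, IConstraint.rel R x y ∈ st.cs)
      (h1 : IConstraint.sat y ψ ∉ st.cs) (h2 : IConstraint.sat y ψ.nnfNeg ∉ st.cs)
      (hχ : χ = ψ ∨ χ = ψ.nnfNeg)
      (hS' : (S' : Set IConstraint) =
        {c | c ∈ st.cs ∧ ∀ z ∈ c.vars, ¬ Relation.TransGen (precRel st.prec) y z} ∪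
          {IConstraint.sat y χ})
      (hP' : (P' : Set (ℕ × ℕ)) =
        {p | p ∈ st.prec ∧ ¬ Relation.TransGen (precRel st.prec) y p.1 ∧
             ¬ Relation.TransGen (precRel st.prec) y p.2}) :
      IStep st ⟨S', P'⟩
  | ge (st : IState) (S' : Finset IConstraint) (x : ℕ) (ω : RelInter) (n : ℕ)
      (ψ : GIFormula) (y : ℕ) (ρ : Finset GRel) (f : GIFormula → GIFormula)
      (h : IConstraint.sat x (.ge ω n ψ) ∈ st.cs)
      (hc : countI st.cs ω x ψ < n)
      (hng : ¬ iAndApplicable st.cs x ∧ ¬ iOrApplicable st.cs x ∧ ¬ iChooseApplicable st.cs x)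
      (hfresh : (∀ c ∈ st.cs, y ∉ c.vars) ∧ ∀ p ∈ st.prec, y ≠ p.1 ∧ y ≠ p.2)
      (hρ : ω.1 ⊆ ρ)
      (hf : ∀ ψ', f ψ' = ψ' ∨ f ψ' = ψ'.nnfNeg)
      (hS' : (S' : Set IConstraint) = (st.cs : Set IConstraint) ∪ {IConstraint.sat y ψ} ∪
          {c | ∃ ψ' σ m,
            (IConstraint.sat x (.ge σ m ψ') ∈ st.cs ∨ IConstraint.sat x (.le σ m ψ') ∈ st.cs) ∧
            c = IConstraint.sat y (f ψ')} ∪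
          {c | ∃ R ∈ ρ, c = IConstraint.rel R x y ∨ c = IConstraint.rel R.inverse y x}) :
      IStep st ⟨S', insert (x, y) st.prec⟩

/-- The initial state ({x₀ ⊨ φ}, ∅). -/
def initI (x₀ : ℕ) (φ : GIFormula) : IState := ⟨{IConstraint.sat x₀ φ}, ∅⟩

/-- st is obtained from ({x₀ ⊨ φ}, ∅) by a sequence of rule applications. -/
def IReach (x₀ : ℕ) (φ : GIFormula) (st : IState) : Prop :=
  Relation.ReflTransGen IStep (initI x₀ φ) st

/-- A state is complete iff no Gr(K_{R⁻¹∩})-rule is applicable. -/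
def ICompleteState (st : IState) : Prop := ¬ ∃ st', IStep st st'

/-- The canonical structure induced by a Gr(K_{R⁻¹∩}) constraint system. -/
def canonicalI (S : Finset IConstraint) : Kripke where
  W := ℕ
  nonempty := ⟨0⟩
  rel := fun r x y => IConstraint.rel (GRel.name r) x y ∈ S
  val := fun p => {x | IConstraint.sat x (.atom p) ∈ S}

/-- The inclusion of Gr(K_R)-formulae into Gr(K_{R⁻¹∩})-formulae. -/
def GFormula.toGI : GFormula → GIFormula
  | .atom p => .atom p
  | .neg φ => .neg φ.toGI
  | .and φ ψ => .and φ.toGI ψ.toGI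
  | .or φ ψ => .or φ.toGI ψ.toGI
  | .ge r n φ => .ge ⟨{GRel.name r}, Finset.singleton_nonempty _⟩ n φ.toGI
  | .le r n φ => .le ⟨{GRel.name r}, Finset.singleton_nonempty _⟩ n φ.toGI

end GrK

namespace GrK

/-- Modal depth. -/
def GIFormula.md : GIFormula → ℕ
  | .atom _ => 0
  | .neg φ => φ.md
  | .and φ ψ => max φ.md ψ.md
  | .or φ ψ => max φ.md ψ.md
  | .ge _ _ φ => φ.md + 1
  | .le _ _ φ => φ.md + 1

/-- Subformulae. -/
noncomputable def GIFormula.sub : GIFormula → Finset GIFormula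
  | .atom p => {.atom p}
  | .neg φ => insert (.neg φ) φ.sub
  | .and φ ψ => insert (.and φ ψ) (φ.sub ∪ ψ.sub)
  | .or φ ψ => insert (.or φ ψ) (φ.sub ∪ ψ.sub)
  | .ge r n φ => insert (.ge r n φ) φ.sub
  | .le r n φ => insert (.le r n φ) φ.sub

theorem md_nnfNeg (φ : GIFormula) : φ.nnfNeg.md ≤ φ.md := by
  induction φ with
  | atom p => simp [GIFormula.nnfNeg, GIFormula.md]
  | neg φ ih => simp [GIFormula.nnfNeg, GIFormula.md]
  | and a b iha ihb => simp only [GIFormula.nnfNeg, GIFormula.md]; omega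
  | or a b iha ihb => simp only [GIFormula.nnfNeg, GIFormula.md]; omega
  | ge ω n φ ih =>
    simp only [GIFormula.nnfNeg]
    split_ifs <;> simp [GIFormula.md]
  | le ω n φ ih => simp [GIFormula.nnfNeg, GIFormula.md]

theorem sat_nnfNeg (M : Kripke) (φ : GIFormula) (x : M.W) :
    φ.nnfNeg.sat M x ↔ ¬ φ.sat M x := by
  induction φ generalizing x with
  | atom p => simp [GIFormula.nnfNeg, GIFormula.sat]
  | neg φ ih => simp [GIFormula.nnfNeg, GIFormula.sat]
  | and a b iha ihb => simp only [GIFormula.nnfNeg, GIFormula.sat, iha, ihb]; tauto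
  | or a b iha ihb => simp only [GIFormula.nnfNeg, GIFormula.sat, iha, ihb]; tauto
  | ge ω n φ ih =>
    simp only [GIFormula.nnfNeg]
    split_ifs with h
    · subst h; simp [GIFormula.sat]
    · obtain ⟨m, rfl⟩ := Nat.exists_eq_succ_of_ne_zero h
      simp only [GIFormula.sat, not_le, Nat.succ_eq_add_one, Nat.add_sub_cancel]
      rw [Nat.cast_add, Nat.cast_one, ← Cardinal.succ_natCast, Order.lt_succ_iff]
  | le ω n φ ih =>
    simp only [GIFormula.nnfNeg, GIFormula.sat, not_le]
    rw [Nat.cast_add, Nat.cast_one, ← Cardinal.succ_natCast, Order.succ_le_iff]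

theorem self_mem_sub (φ : GIFormula) : φ ∈ φ.sub := by
  cases φ <;> simp [GIFormula.sub]

theorem sub_trans {φ ψ : GIFormula} (h : ψ ∈ φ.sub) : ψ.sub ⊆ φ.sub := by
  induction φ with
  | atom p => simp [GIFormula.sub] at h; subst h; rfl
  | neg φ ih =>
    simp only [GIFormula.sub, Finset.mem_insert] at h
    rcases h with rfl | h
    · rfl
    · exact (ih h).trans (by simp [GIFormula.sub])
  | and a b iha ihb =>
    simp only [GIFormula.sub, Finset.mem_insert, Finset.mem_union] at h
    rcases h with rfl | h | h
    · rfl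
    · exact (iha h).trans (by intro z hz; simp [GIFormula.sub, hz])
    · exact (ihb h).trans (by intro z hz; simp [GIFormula.sub, hz])
  | or a b iha ihb =>
    simp only [GIFormula.sub, Finset.mem_insert, Finset.mem_union] at h
    rcases h with rfl | h | h
    · rfl
    · exact (iha h).trans (by intro z hz; simp [GIFormula.sub, hz])
    · exact (ihb h).trans (by intro z hz; simp [GIFormula.sub, hz])
  | ge ω n φ ih =>
    simp only [GIFormula.sub, Finset.mem_insert] at h
    rcases h with rfl | h
    · rfl
    · exact (ih h).trans (by simp [GIFormula.sub])
  | le ω n φ ih =>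
    simp only [GIFormula.sub, Finset.mem_insert] at h
    rcases h with rfl | h
    · rfl
    · exact (ih h).trans (by simp [GIFormula.sub])

/-- Closed finite sets of formulae. -/
structure Closed (C : Finset GIFormula) : Prop where
  and : ∀ a b, GIFormula.and a b ∈ C → a ∈ C ∧ b ∈ C
  or : ∀ a b, GIFormula.or a b ∈ C → a ∈ C ∧ b ∈ C
  ge : ∀ ω n a, GIFormula.ge ω n a ∈ C → a ∈ C ∧ a.nnfNeg ∈ C
  le : ∀ ω n a, GIFormula.le ω n a ∈ C → a ∈ C ∧ a.nnfNeg ∈ C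

theorem exists_closed (φ : GIFormula) : ∃ C : Finset GIFormula, φ ∈ C ∧ Closed C := by
  have hand : ∀ a b, GIFormula.and a b ∈ φ.sub → a ∈ φ.sub ∧ b ∈ φ.sub := fun a b h =>
    ⟨sub_trans h (by simp [GIFormula.sub, self_mem_sub]),
     sub_trans h (by simp [GIFormula.sub, self_mem_sub])⟩
  have hor : ∀ a b, GIFormula.or a b ∈ φ.sub → a ∈ φ.sub ∧ b ∈ φ.sub := fun a b h =>
    ⟨sub_trans h (by simp [GIFormula.sub, self_mem_sub]),
     sub_trans h (by simp [GIFormula.sub, self_mem_sub])⟩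
  have hge : ∀ ω n a, GIFormula.ge ω n a ∈ φ.sub → a ∈ φ.sub := fun ω n a h =>
    sub_trans h (by simp [GIFormula.sub, self_mem_sub])
  have hle : ∀ ω n a, GIFormula.le ω n a ∈ φ.sub → a ∈ φ.sub := fun ω n a h =>
    sub_trans h (by simp [GIFormula.sub, self_mem_sub])
  have hneg : ∀ a, GIFormula.neg a ∈ φ.sub → a ∈ φ.sub := fun a h =>
    sub_trans h (by simp [GIFormula.sub, self_mem_sub])
  set X : Finset GIFormula := {.and (.atom 0) (.neg (.atom 0)), .atom 0, .neg (.atom 0)} with hX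
  have key : ∀ θ ∈ φ.sub ∪ φ.sub.image GIFormula.nnfNeg ∪ X,
      θ ∈ φ.sub ∨ (∃ a ∈ φ.sub, a.nnfNeg = θ ∧ ∀ b, a ≠ .neg b) ∨ θ ∈ X := by
    intro θ h
    simp only [Finset.mem_union, Finset.mem_image] at h
    rcases h with (h | ⟨a, ha, rfl⟩) | h
    · exact Or.inl h
    · by_cases hb : ∃ b, a = .neg b
      · obtain ⟨b, rfl⟩ := hb
        exact Or.inl (hneg _ ha)
      · push Not at hb
        exact Or.inr (Or.inl ⟨a, ha, rfl, hb⟩)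
    · exact Or.inr (Or.inr h)
  have m1 : ∀ a ∈ φ.sub, a ∈ φ.sub ∪ φ.sub.image GIFormula.nnfNeg ∪ X := by
    intro a ha; simp [ha]
  have m2 : ∀ a ∈ φ.sub, a.nnfNeg ∈ φ.sub ∪ φ.sub.image GIFormula.nnfNeg ∪ X := by
    intro a ha
    exact Finset.mem_union_left _ (Finset.mem_union_right _ (Finset.mem_image_of_mem _ ha))
  have m3 : ∀ a ∈ X, a ∈ φ.sub ∪ φ.sub.image GIFormula.nnfNeg ∪ X := by
    intro a ha; exact Finset.mem_union_right _ ha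
  refine ⟨φ.sub ∪ φ.sub.image GIFormula.nnfNeg ∪ X, m1 _ (self_mem_sub φ), ?_, ?_, ?_, ?_⟩
  · intro a b h
    rcases key _ h with h | ⟨c, hc, he, hn⟩ | h
    · exact ⟨m1 _ (hand _ _ h).1, m1 _ (hand _ _ h).2⟩
    · cases c with
      | neg c => exact absurd rfl (hn c)
      | or p q =>
        simp only [GIFormula.nnfNeg, GIFormula.and.injEq] at he
        obtain ⟨rfl, rfl⟩ := he
        exact ⟨m2 _ (hor _ _ hc).1, m2 _ (hor _ _ hc).2⟩
      | ge ω n p =>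
        simp only [GIFormula.nnfNeg] at he
        split_ifs at he
        simp only [GIFormula.and.injEq] at he
        obtain ⟨rfl, rfl⟩ := he
        exact ⟨m3 _ (by simp [hX]), m3 _ (by simp [hX])⟩
      | _ => simp [GIFormula.nnfNeg] at he
    · simp [hX] at h
      obtain ⟨rfl, rfl⟩ := h
      exact ⟨m3 _ (by simp [hX]), m3 _ (by simp [hX])⟩
  · intro a b h
    rcases key _ h with h | ⟨c, hc, he, hn⟩ | h
    · exact ⟨m1 _ (hor _ _ h).1, m1 _ (hor _ _ h).2⟩
    · cases c with
      | neg c => exact absurd rfl (hn c)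
      | and p q =>
        simp only [GIFormula.nnfNeg, GIFormula.or.injEq] at he
        obtain ⟨rfl, rfl⟩ := he
        exact ⟨m2 _ (hand _ _ hc).1, m2 _ (hand _ _ hc).2⟩
      | ge ω n p =>
        simp only [GIFormula.nnfNeg] at he
        split_ifs at he
      | _ => simp [GIFormula.nnfNeg] at he
    · simp [hX] at h
  · intro ω n a h
    rcases key _ h with h | ⟨c, hc, he, hn⟩ | h
    · exact ⟨m1 _ (hge _ _ _ h), m2 _ (hge _ _ _ h)⟩
    · cases c with
      | neg c => exact absurd rfl (hn c)
      | le ω n p =>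
        simp only [GIFormula.nnfNeg, GIFormula.ge.injEq] at he
        obtain ⟨-, -, rfl⟩ := he
        exact ⟨m1 _ (hle _ _ _ hc), m2 _ (hle _ _ _ hc)⟩
      | ge ω n p =>
        simp only [GIFormula.nnfNeg] at he
        split_ifs at he
      | _ => simp [GIFormula.nnfNeg] at he
    · simp [hX] at h
  · intro ω n a h
    rcases key _ h with h | ⟨c, hc, he, hn⟩ | h
    · exact ⟨m1 _ (hle _ _ _ h), m2 _ (hle _ _ _ h)⟩
    · cases c with
      | neg c => exact absurd rfl (hn c)
      | ge ω n p =>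
        simp only [GIFormula.nnfNeg] at he
        split_ifs at he
        simp only [GIFormula.le.injEq] at he
        obtain ⟨-, -, rfl⟩ := he
        exact ⟨m1 _ (hge _ _ _ hc), m2 _ (hge _ _ _ hc)⟩
      | _ => simp [GIFormula.nnfNeg] at he
    · simp [hX] at h

/-- Relations at the head of a formula. -/
def GIFormula.headRels : GIFormula → Finset GRel
  | .ge ω _ _ => ω.1
  | .le ω _ _ => ω.1
  | _ => ∅

theorem inverse_inverse (R : GRel) : R.inverse.inverse = R := by cases R <;> rfl

theorem interp_inverse (M : Kripke) (R : GRel) (x y : M.W) :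
    R.inverse.interp M x y ↔ R.interp M y x := by cases R <;> rfl

theorem exists_rels (C : Finset GIFormula) : ∃ Q : Finset GRel,
    (∀ ω n a, GIFormula.ge ω n a ∈ C → ω.1 ⊆ Q) ∧ (∀ R ∈ Q, R.inverse ∈ Q) := by
  refine ⟨C.biUnion GIFormula.headRels ∪ (C.biUnion GIFormula.headRels).image GRel.inverse, ?_, ?_⟩
  · intro ω n a h R hR
    exact Finset.mem_union_left _ (Finset.mem_biUnion.2 ⟨_, h, hR⟩)
  · intro R hR
    rcases Finset.mem_union.1 hR with h | h
    · exact Finset.mem_union_right _ (Finset.mem_image_of_mem _ h)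
    · obtain ⟨R', h', rfl⟩ := Finset.mem_image.1 h
      rw [inverse_inverse]; exact Finset.mem_union_left _ h'

/-! ### The termination measure -/

theorem sat_finite (S : Finset IConstraint) (ψ : GIFormula) :
    {y : ℕ | IConstraint.sat y ψ ∈ S}.Finite := by
  apply Set.Finite.preimage (f := fun y => IConstraint.sat y ψ) _ S.finite_toSet
  intro a _ b _ h
  simpa using h

theorem countI_finite (S : Finset IConstraint) (ω : RelInter) (x : ℕ) (ψ : GIFormula) :
    {y : ℕ | (∀ R ∈ ω.1, IConstraint.rel R x y ∈ S) ∧ IConstraint.sat y ψ ∈ S}.Finite :=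
  (sat_finite S ψ).subset fun _ h => h.2

theorem countI_mono {S S' : Finset IConstraint} {ω : RelInter} {x : ℕ} {ψ : GIFormula}
    (h : ∀ y, (∀ R ∈ ω.1, IConstraint.rel R x y ∈ S) → IConstraint.sat y ψ ∈ S →
      (∀ R ∈ ω.1, IConstraint.rel R x y ∈ S') ∧ IConstraint.sat y ψ ∈ S') :
    countI S ω x ψ ≤ countI S' ω x ψ :=
  Set.ncard_le_ncard (fun y hy => h y hy.1 hy.2) (countI_finite _ _ _ _)

open Classical in
/-- Nodes at level k. -/
noncomputable def nodes (S : Finset IConstraint) (lv : ℕ → ℕ) (k : ℕ) : Finset ℕ :=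
  (S.biUnion IConstraint.vars).filter fun x => lv x = k ∧ ∃ ψ, IConstraint.sat x ψ ∈ S

theorem mem_nodes {S : Finset IConstraint} {lv : ℕ → ℕ} {k x : ℕ} :
    x ∈ nodes S lv k ↔ lv x = k ∧ ∃ ψ, IConstraint.sat x ψ ∈ S := by
  simp only [nodes, Finset.mem_filter, Finset.mem_biUnion, and_iff_right_iff_imp]
  rintro ⟨-, ψ, h⟩
  exact ⟨_, h, by simp [IConstraint.vars]⟩

/-- Missing-label indicator. -/
noncomputable def cM (S : Finset IConstraint) (x : ℕ) (ψ : GIFormula) : ℕ :=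
  if IConstraint.sat x ψ ∈ S then 0 else 1

/-- Remaining generation budget. -/
noncomputable def gM (S : Finset IConstraint) (x : ℕ) : GIFormula → ℕ
  | .ge ω n ψ => if IConstraint.sat x (.ge ω n ψ) ∈ S then n - countI S ω x ψ else 0
  | _ => 0

theorem gM_le {S S' : Finset IConstraint} {x : ℕ} (θ : GIFormula)
    (h1 : ∀ ψ, IConstraint.sat x ψ ∈ S' → IConstraint.sat x ψ ∈ S)
    (h2 : ∀ y R ψ, IConstraint.rel R x y ∈ S → IConstraint.sat y ψ ∈ S →
      IConstraint.sat y ψ ∈ S')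
    (h3 : ∀ y R, IConstraint.rel R x y ∈ S → IConstraint.rel R x y ∈ S') :
    gM S' x θ ≤ gM S x θ := by
  cases θ with
  | ge ω n ψ =>
    simp only [gM]
    split_ifs with a b b
    · apply Nat.sub_le_sub_left
      apply countI_mono
      intro y hy hs
      obtain ⟨R, hR⟩ := ω.2
      exact ⟨fun R hR => h3 _ _ (hy R hR), h2 y R ψ (hy R hR) hs⟩
    · exact absurd (h1 _ a) b
    · exact Nat.zero_le _
    · exact Nat.zero_le _
  | _ => simp [gM]

/-- The termination measure at a level. -/
noncomputable def mu (C : Finset GIFormula) (S : Finset IConstraint) (lv : ℕ → ℕ) (k : ℕ) :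
    ℕ ×ₗ ℕ :=
  toLex (∑ x ∈ nodes S lv k, ∑ ψ ∈ C, cM S x ψ, ∑ x ∈ nodes S lv k, ∑ ψ ∈ C, gM S x ψ)

theorem mu_le {C : Finset GIFormula} {S S' : Finset IConstraint} {lv lv' : ℕ → ℕ} {k : ℕ}
    (hn : nodes S' lv' k = nodes S lv k)
    (hc : ∀ x ∈ nodes S lv k, ∀ ψ, cM S' x ψ ≤ cM S x ψ)
    (hg : ∀ x ∈ nodes S lv k, ∀ ψ, gM S' x ψ ≤ gM S x ψ) : mu C S' lv' k ≤ mu C S lv k := by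
  unfold mu
  rw [hn]
  apply Prod.Lex.toLex_mono
  exact ⟨Finset.sum_le_sum fun x hx => Finset.sum_le_sum fun ψ _ => hc x hx ψ,
    Finset.sum_le_sum fun x hx => Finset.sum_le_sum fun ψ _ => hg x hx ψ⟩

theorem mu_lt_c {C : Finset GIFormula} {S S' : Finset IConstraint} {lv lv' : ℕ → ℕ} {k : ℕ}
    (hn : nodes S' lv' k = nodes S lv k)
    (hc : ∀ x ∈ nodes S lv k, ∀ ψ, cM S' x ψ ≤ cM S x ψ)
    (hs : ∃ x ∈ nodes S lv k, ∃ ψ ∈ C, cM S' x ψ < cM S x ψ) :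
    mu C S' lv' k < mu C S lv k := by
  unfold mu
  rw [hn]
  rw [Prod.Lex.toLex_lt_toLex]
  left
  obtain ⟨x, hx, ψ, hψ, h⟩ := hs
  exact Finset.sum_lt_sum (fun x hx => Finset.sum_le_sum fun ψ _ => hc x hx ψ)
    ⟨x, hx, Finset.sum_lt_sum (fun ψ _ => hc x hx ψ) ⟨ψ, hψ, h⟩⟩

theorem mu_lt_g {C : Finset GIFormula} {S S' : Finset IConstraint} {lv lv' : ℕ → ℕ} {k : ℕ}
    (hn : nodes S' lv' k = nodes S lv k)
    (hc : ∀ x ∈ nodes S lv k, ∀ ψ, cM S' x ψ = cM S x ψ)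
    (hg : ∀ x ∈ nodes S lv k, ∀ ψ, gM S' x ψ ≤ gM S x ψ)
    (hs : ∃ x ∈ nodes S lv k, ∃ ψ ∈ C, gM S' x ψ < gM S x ψ) :
    mu C S' lv' k < mu C S lv k := by
  unfold mu
  rw [hn]
  rw [Prod.Lex.toLex_lt_toLex]
  right
  obtain ⟨x, hx, ψ, hψ, h⟩ := hs
  exact ⟨Finset.sum_congr rfl fun x hx => Finset.sum_congr rfl fun ψ _ => hc x hx ψ,
    Finset.sum_lt_sum (fun x hx => Finset.sum_le_sum fun ψ _ => hg x hx ψ)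
    ⟨x, hx, Finset.sum_lt_sum (fun ψ _ => hg x hx ψ) ⟨ψ, hψ, h⟩⟩⟩

/-- Lexicographic comparison of the first D+1 levels. -/
def LexLT (D : ℕ) (a b : ℕ → ℕ ×ₗ ℕ) : Prop :=
  ∃ k ≤ D, (∀ j < k, a j ≤ b j) ∧ a k < b k

theorem lexLT_wf (D : ℕ) : WellFounded (LexLT D) := by
  have wf : WellFounded (fun a b : Lex (Fin (D + 1) → ℕ ×ₗ ℕ) => a < b) := wellFounded_lt
  refine Subrelation.wf ?_ (InvImage.wf
    (fun a : ℕ → ℕ ×ₗ ℕ => (toLex (fun i : Fin (D + 1) => a i) : Lex (Fin (D + 1) → ℕ ×ₗ ℕ))) wf)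
  rintro a b ⟨k, hk, h1, h2⟩
  have hex : ∃ i, a i ≠ b i := ⟨k, h2.ne⟩
  classical
  have hle : Nat.find hex ≤ k := Nat.find_min' hex h2.ne
  refine ⟨⟨Nat.find hex, by omega⟩, ?_, ?_⟩
  · intro j hj
    have := Nat.find_min hex (m := j) hj
    simpa using this
  · rcases hle.lt_or_eq with h | h
    · exact lt_of_le_of_ne (h1 _ h) (Nat.find_spec hex)
    · show a (Nat.find hex) < b (Nat.find hex)
      rw [h]; exact h2

/-- A non-generating step decreases the measure. -/
theorem mu_nongen {C : Finset GIFormula} {S S' : Finset IConstraint} {lv : ℕ → ℕ} {D k : ℕ}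
    (hD : k ≤ D)
    (h1 : ∀ u ψ, lv u ≤ k → IConstraint.sat u ψ ∈ S → IConstraint.sat u ψ ∈ S')
    (h2 : ∀ u ψ, lv u < k → IConstraint.sat u ψ ∈ S' → IConstraint.sat u ψ ∈ S)
    (h3 : ∀ R u v, lv u ≤ k → lv v ≤ k → IConstraint.rel R u v ∈ S → IConstraint.rel R u v ∈ S')
    (h4 : ∀ u ψ, lv u = k → IConstraint.sat u ψ ∈ S' → ∃ ψ', IConstraint.sat u ψ' ∈ S)
    (h5 : ∃ x, lv x = k ∧ (∃ ψ, IConstraint.sat x ψ ∈ S) ∧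
      ∃ ψ ∈ C, IConstraint.sat x ψ ∉ S ∧ IConstraint.sat x ψ ∈ S')
    (h6 : ∀ R u v, IConstraint.rel R u v ∈ S → lv v ≤ lv u + 1) :
    LexLT D (mu C S' lv) (mu C S lv) := by
  have hn : ∀ j ≤ k, nodes S' lv j = nodes S lv j := by
    intro j hj
    ext u
    simp only [mem_nodes]
    constructor
    · rintro ⟨rfl, ψ, h⟩
      rcases hj.lt_or_eq with h' | h'
      · exact ⟨rfl, ψ, h2 _ _ h' h⟩
      · exact ⟨rfl, h4 _ _ h' h⟩
    · rintro ⟨rfl, ψ, h⟩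
      exact ⟨rfl, ψ, h1 _ _ hj h⟩
  have hc : ∀ j ≤ k, ∀ x ∈ nodes S lv j, ∀ ψ, cM S' x ψ ≤ cM S x ψ := by
    intro j hj x hx ψ
    have := h1 x ψ (by rw [(mem_nodes.1 hx).1]; exact hj)
    unfold cM
    split_ifs <;> simp_all
  refine ⟨k, hD, ?_, ?_⟩
  · intro j hj
    refine mu_le (hn j hj.le) (hc j hj.le) ?_
    intro x hx ψ
    obtain ⟨rfl, -⟩ := mem_nodes.1 hx
    apply gM_le
    · exact fun ψ h => h2 _ _ hj h
    · intro y R ψ hr hs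
      exact h1 _ _ ((h6 _ _ _ hr).trans hj) hs
    · intro y R hr
      exact h3 _ _ _ hj.le ((h6 _ _ _ hr).trans hj) hr
  · apply mu_lt_c (hn k le_rfl) (hc k le_rfl)
    obtain ⟨x, hx, hx', ψ, hψ, a, b⟩ := h5
    exact ⟨x, mem_nodes.2 ⟨hx, hx'⟩, ψ, hψ, by simp [cM, a, b]⟩

/-! ### The invariant -/

/-- Adjacency in the tree. -/
def adjP (P : Finset (ℕ × ℕ)) (u v : ℕ) : Prop := (u, v) ∈ P ∨ (v, u) ∈ P

/-- The invariant of the guided run. -/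
structure Inv (M : Kripke) (C : Finset GIFormula) (Q : Finset GRel) (D : ℕ)
    (S : Finset IConstraint) (P : Finset (ℕ × ℕ)) (α : ℕ → M.W) (lv : ℕ → ℕ) : Prop where
  sat : ∀ x ψ, IConstraint.sat x ψ ∈ S → ψ.sat M (α x) ∧ ψ ∈ C ∧ ψ.md + lv x ≤ D
  rel : ∀ R x y, IConstraint.rel R x y ∈ S → adjP P x y ∧ R.interp M (α x) (α y)
  maxl : ∀ R ∈ Q, ∀ x y, adjP P x y → R.interp M (α x) (α y) → IConstraint.rel R x y ∈ S
  inj : ∀ x y z, adjP P x y → adjP P x z → α y = α z → y = z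
  lev : ∀ x y, (x, y) ∈ P → lv y = lv x + 1
  node : ∀ x y, (x, y) ∈ P → (∃ ψ, IConstraint.sat x ψ ∈ S) ∧ ∃ ψ, IConstraint.sat y ψ ∈ S

theorem Inv.adj_lv {M C Q D S P} {α : ℕ → M.W} {lv} (I : Inv M C Q D S P α lv) {x y : ℕ}
    (h : adjP P x y) : lv y ≤ lv x + 1 := by
  rcases h with h | h <;> have := I.lev _ _ h <;> omega

theorem Inv.not_clash {M C Q D S P} {α : ℕ → M.W} {lv} (I : Inv M C Q D S P α lv) :
    ¬ hasClashI S := by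
  rintro (⟨x, p, h1, h2⟩ | ⟨x, ω, n, ψ, h, hc⟩)
  · exact (I.sat _ _ h2).1 (I.sat _ _ h1).1
  · have h1 := (I.sat _ _ h).1
    simp only [GIFormula.sat] at h1
    have fin := countI_finite S ω x ψ
    have hle : Cardinal.mk
        {y : ℕ | (∀ R ∈ ω.1, IConstraint.rel R x y ∈ S) ∧ IConstraint.sat y ψ ∈ S} ≤
        Cardinal.mk {y : M.W // (∀ R ∈ ω.1, GRel.interp M R (α x) y) ∧ GIFormula.sat M ψ y} := by
      refine Cardinal.mk_le_of_injective (f := fun y => ⟨α y.1,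
        fun R hR => (I.rel _ _ _ (y.2.1 R hR)).2, (I.sat _ _ y.2.2).1⟩) ?_
      intro a b hab
      obtain ⟨R, hR⟩ := ω.2
      apply Subtype.ext
      exact I.inj x _ _ (I.rel _ _ _ (a.2.1 R hR)).1 (I.rel _ _ _ (b.2.1 R hR)).1
        (by simpa using hab)
    have := hle.trans h1
    rw [← Set.cast_ncard fin] at this
    have h3 : countI S ω x ψ ≤ n := by exact_mod_cast this
    omega

/-- Adding formulae to an existing node preserves the invariant. -/
theorem Inv.insert {M C Q D S P} {α : ℕ → M.W} {lv} (I : Inv M C Q D S P α lv) {x : ℕ}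
    {χ : GIFormula} (h1 : χ.sat M (α x)) (h2 : χ ∈ C) (h3 : χ.md + lv x ≤ D) :
    Inv M C Q D (insert (IConstraint.sat x χ) S) P α lv where
  sat := by
    intro z ψ h
    rcases Finset.mem_insert.1 h with h | h
    · simp only [IConstraint.sat.injEq] at h
      obtain ⟨rfl, rfl⟩ := h
      exact ⟨h1, h2, h3⟩
    · exact I.sat _ _ h
  rel := by
    intro R a b h
    rcases Finset.mem_insert.1 h with h | h
    · simp at h
    · exact I.rel _ _ _ h
  maxl := fun R hR a b h h' => Finset.mem_insert_of_mem (I.maxl R hR a b h h')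
  inj := I.inj
  lev := I.lev
  node := fun a b h => by
    obtain ⟨⟨p, hp⟩, ⟨q, hq⟩⟩ := I.node a b h
    exact ⟨⟨p, Finset.mem_insert_of_mem hp⟩, ⟨q, Finset.mem_insert_of_mem hq⟩⟩

theorem mu_insert {M C Q D S P} {α : ℕ → M.W} {lv} (I : Inv M C Q D S P α lv) {x : ℕ}
    {S' : Finset IConstraint} {χ : GIFormula} (h0 : ∃ ψ, IConstraint.sat x ψ ∈ S)
    (h2 : χ ∈ C) (hn : IConstraint.sat x χ ∉ S) (hm : IConstraint.sat x χ ∈ S')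
    (hsub : S ⊆ S')
    (hS : ∀ z ψ, IConstraint.sat z ψ ∈ S' → IConstraint.sat z ψ ∈ S ∨ z = x) :
    LexLT D (mu C S' lv) (mu C S lv) := by
  obtain ⟨ψ₀, hψ₀⟩ := h0
  have hD := (I.sat _ _ hψ₀).2.2
  apply mu_nongen (k := lv x) (by omega)
  · exact fun u ψ _ h => hsub h
  · intro u ψ hu h
    rcases hS _ _ h with h | rfl
    · exact h
    · omega
  · exact fun R u v _ _ h => hsub h
  · intro u ψ hu h
    rcases hS _ _ h with h | rfl
    · exact ⟨_, h⟩
    · exact ⟨_, hψ₀⟩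
  · exact ⟨x, rfl, ⟨_, hψ₀⟩, χ, h2, hn, hm⟩
  · exact fun R u v h => I.adj_lv (I.rel _ _ _ h).1

theorem Inv.desc_lv {M C Q D S P} {α : ℕ → M.W} {lv} (I : Inv M C Q D S P α lv) {y z : ℕ}
    (h : Relation.TransGen (precRel P) y z) : lv y < lv z := by
  induction h with
  | single h => have := I.lev _ _ h; omega
  | tail _ h ih => have := I.lev _ _ h; omega

open Classical in
/-- Pruning of the descendants preserves the invariant. -/
theorem Inv.prune {M C Q D S P} {α : ℕ → M.W} {lv} (I : Inv M C Q D S P α lv) (y : ℕ)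
    {P' : Finset (ℕ × ℕ)}
    (hP' : (P' : Set (ℕ × ℕ)) =
        {p | p ∈ P ∧ ¬ Relation.TransGen (precRel P) y p.1 ∧
             ¬ Relation.TransGen (precRel P) y p.2}) :
    Inv M C Q D (S.filter fun c => ∀ z ∈ c.vars, ¬ Relation.TransGen (precRel P) y z) P' α lv := by
  have hP : ∀ a b, (a, b) ∈ P' ↔ (a, b) ∈ P ∧ ¬ Relation.TransGen (precRel P) y a ∧
             ¬ Relation.TransGen (precRel P) y b := by
    intro a b
    rw [← Finset.mem_coe, hP']; rfl
  have hadj : ∀ a b, adjP P' a b ↔ adjP P a b ∧ ¬ Relation.TransGen (precRel P) y a ∧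
             ¬ Relation.TransGen (precRel P) y b := by
    intro a b
    simp only [adjP, hP]; tauto
  constructor
  · intro x ψ h
    exact I.sat _ _ (Finset.mem_filter.1 h).1
  · intro R a b h
    obtain ⟨h, h'⟩ := Finset.mem_filter.1 h
    refine ⟨(hadj _ _).2 ⟨(I.rel _ _ _ h).1, h' _ ?_, h' _ ?_⟩, (I.rel _ _ _ h).2⟩ <;>
      simp [IConstraint.vars]
  · intro R hR a b h h'
    obtain ⟨h, ha, hb⟩ := (hadj _ _).1 h
    refine Finset.mem_filter.2 ⟨I.maxl R hR _ _ h h', ?_⟩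
    simp [IConstraint.vars, ha, hb]
  · intro a b c h h'
    exact I.inj a b c ((hadj _ _).1 h).1 ((hadj _ _).1 h').1
  · intro a b h
    exact I.lev _ _ ((hP _ _).1 h).1
  · intro a b h
    obtain ⟨h, ha, hb⟩ := (hP _ _).1 h
    obtain ⟨⟨p, hp⟩, ⟨q, hq⟩⟩ := I.node _ _ h
    refine ⟨⟨p, Finset.mem_filter.2 ⟨hp, ?_⟩⟩, ⟨q, Finset.mem_filter.2 ⟨hq, ?_⟩⟩⟩ <;>
      simp [IConstraint.vars, ha, hb]

/-- Choice of the new world in the generating rule. -/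
theorem Inv.exists_world {M C Q D S P} {α : ℕ → M.W} {lv} (I : Inv M C Q D S P α lv)
    (hQ : ∀ ω n a, GIFormula.ge ω n a ∈ C → ω.1 ⊆ Q)
    {x n : ℕ} {ω : RelInter} {ψ : GIFormula} (h : IConstraint.sat x (.ge ω n ψ) ∈ S)
    (hc : countI S ω x ψ < n) (hch : ¬ iChooseApplicable S x) :
    ∃ w : M.W, (∀ R ∈ ω.1, GRel.interp M R (α x) w) ∧ ψ.sat M w ∧
      ∀ z, adjP P x z → α z ≠ w := by
  obtain ⟨hs, hC, -⟩ := I.sat _ _ h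
  simp only [GIFormula.sat] at hs
  by_contra hcon
  push Not at hcon
  have fin := countI_finite S ω x ψ
  set A := {y : ℕ | (∀ R ∈ ω.1, IConstraint.rel R x y ∈ S) ∧ IConstraint.sat y ψ ∈ S} with hA
  have key : ∀ w : {y : M.W // (∀ R ∈ ω.1, GRel.interp M R (α x) y) ∧ GIFormula.sat M ψ y},
      ∃ z : A, α z.1 = w.1 := by
    rintro ⟨w, hw1, hw2⟩
    obtain ⟨z, hz, rfl⟩ := hcon w hw1 hw2
    have hr : ∀ R ∈ ω.1, IConstraint.rel R x z ∈ S := fun R hR =>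
      I.maxl R (hQ _ _ _ hC hR) _ _ hz (hw1 R hR)
    have hz' : IConstraint.sat z ψ ∈ S := by
      by_contra hn
      obtain ⟨R, hR⟩ := ω.2
      refine hch ⟨ω, n, ψ, z, Or.inl h, ⟨R, hR, hr R hR⟩, hn, fun hn' => ?_⟩
      exact (sat_nnfNeg _ _ _).1 (I.sat _ _ hn').1 hw2
    exact ⟨⟨z, hr, hz'⟩, rfl⟩
  choose g hg using key
  have hle := Cardinal.mk_le_of_injective (f := g) (by
    intro a b hab
    apply Subtype.ext
    rw [← hg a, ← hg b, hab])
  have := hs.trans hle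
  rw [← Set.cast_ncard fin] at this
  have h3 : n ≤ countI S ω x ψ := by exact_mod_cast this
  omega

open Classical in
theorem gen_step {M : Kripke} {C : Finset GIFormula} {Q : Finset GRel} {D : ℕ} {st : IState}
    {α : ℕ → M.W} {lv : ℕ → ℕ} (I : Inv M C Q D st.cs st.prec α lv) (hCl : Closed C)
    (hQ : ∀ ω n a, GIFormula.ge ω n a ∈ C → ω.1 ⊆ Q) (hQ' : ∀ R ∈ Q, R.inverse ∈ Q)
    {x : ℕ} {ω : RelInter} {n : ℕ} {ψ : GIFormula} {y : ℕ}
    (h : IConstraint.sat x (.ge ω n ψ) ∈ st.cs)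
    (hc : countI st.cs ω x ψ < n)
    (hng : ¬ iAndApplicable st.cs x ∧ ¬ iOrApplicable st.cs x ∧ ¬ iChooseApplicable st.cs x)
    (hfresh : (∀ c ∈ st.cs, y ∉ c.vars) ∧ ∀ p ∈ st.prec, y ≠ p.1 ∧ y ≠ p.2) :
    ∃ (st' : IState) (α' : ℕ → M.W) (lv' : ℕ → ℕ), IStep st st' ∧
      Inv M C Q D st'.cs st'.prec α' lv' ∧ LexLT D (mu C st'.cs lv') (mu C st.cs lv) := by
  obtain ⟨w, hw1, hw2, hw3⟩ := I.exists_world hQ h hc hng.2.2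
  obtain ⟨hs, hC, hmd⟩ := I.sat _ _ h
  simp only [GIFormula.md] at hmd
  set f : GIFormula → GIFormula := fun θ => if θ.sat M w then θ else θ.nnfNeg with hfdef
  have hf : ∀ θ, f θ = θ ∨ f θ = θ.nnfNeg := by
    intro θ; simp only [hfdef]; split_ifs <;> simp
  have hfs : ∀ θ, (f θ).sat M w := by
    intro θ; simp only [hfdef]; split_ifs with hh
    · exact hh
    · exact (sat_nnfNeg _ _ _).2 hh
  have hfmd : ∀ θ, (f θ).md ≤ θ.md := by
    intro θ; simp only [hfdef]; split_ifs
    · rfl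
    · exact md_nnfNeg θ
  set ρ : Finset GRel := Q.filter fun R => R.interp M (α x) w with hρdef
  set T : Set IConstraint := (st.cs : Set IConstraint) ∪ {IConstraint.sat y ψ} ∪
          {c | ∃ ψ' σ m,
            (IConstraint.sat x (.ge σ m ψ') ∈ st.cs ∨ IConstraint.sat x (.le σ m ψ') ∈ st.cs) ∧
            c = IConstraint.sat y (f ψ')} ∪
          {c | ∃ R ∈ ρ, c = IConstraint.rel R x y ∨ c = IConstraint.rel R.inverse y x} with hT
  have hxC : ∀ θ σ m, (IConstraint.sat x (.ge σ m θ) ∈ st.cs ∨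
      IConstraint.sat x (.le σ m θ) ∈ st.cs) → θ ∈ C ∧ θ.nnfNeg ∈ C ∧ θ.md + 1 + lv x ≤ D := by
    rintro θ σ m (hh | hh)
    · have := I.sat _ _ hh
      exact ⟨(hCl.ge _ _ _ this.2.1).1, (hCl.ge _ _ _ this.2.1).2, this.2.2⟩
    · have := I.sat _ _ hh
      exact ⟨(hCl.le _ _ _ this.2.1).1, (hCl.le _ _ _ this.2.1).2, this.2.2⟩
  have hTfin : T.Finite := by
    refine Set.Finite.union (Set.Finite.union (Set.Finite.union st.cs.finite_toSet
      (Set.finite_singleton _)) ?_) ?_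
    · refine (C.image fun θ => IConstraint.sat y (f θ)).finite_toSet.subset ?_
      rintro c ⟨θ, σ, m, hh, rfl⟩
      exact Finset.mem_coe.2 (Finset.mem_image.2 ⟨θ, (hxC _ _ _ hh).1, rfl⟩)
    · refine ((ρ.image fun R => IConstraint.rel R x y) ∪
        (ρ.image fun R => IConstraint.rel R.inverse y x)).finite_toSet.subset ?_
      rintro c ⟨R, hR, rfl | rfl⟩
      · exact Finset.mem_coe.2 (Finset.mem_union_left _ (Finset.mem_image.2 ⟨R, hR, rfl⟩))
      · exact Finset.mem_coe.2 (Finset.mem_union_right _ (Finset.mem_image.2 ⟨R, hR, rfl⟩))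
  set S' := hTfin.toFinset with hS'
  have hcoe : (S' : Set IConstraint) = T := hTfin.coe_toFinset
  have hmem : ∀ c, c ∈ S' ↔ c ∈ T := fun c => hTfin.mem_toFinset
  have hsub : ∀ c ∈ st.cs, c ∈ S' := fun c hc => (hmem c).2 (Or.inl (Or.inl (Or.inl hc)))
  have hys : ∀ θ, IConstraint.sat y θ ∉ st.cs := fun θ hh =>
    hfresh.1 _ hh (by simp [IConstraint.vars])
  have hxy : x ≠ y := by rintro rfl; exact hys _ h
  have hyP : ∀ a b, (a, b) ∈ st.prec → a ≠ y ∧ b ≠ y := fun a b hh =>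
    ⟨(hfresh.2 _ hh).1.symm, (hfresh.2 _ hh).2.symm⟩
  have hadjy : ∀ a b, adjP st.prec a b → a ≠ y ∧ b ≠ y := by
    rintro a b (hh | hh)
    · exact hyP _ _ hh
    · exact (hyP _ _ hh).symm
  have hadj : ∀ a b, adjP (insert (x, y) st.prec) a b ↔
      adjP st.prec a b ∨ (a = x ∧ b = y) ∨ (a = y ∧ b = x) := by
    intro a b
    simp only [adjP, Finset.mem_insert, Prod.mk.injEq]; tauto
  have hsat' : ∀ z θ, z ≠ y → (IConstraint.sat z θ ∈ S' ↔ IConstraint.sat z θ ∈ st.cs) := by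
    intro z θ hz
    rw [hmem]
    constructor
    · rintro (((hh | hh) | ⟨_, _, _, _, hh⟩) | ⟨R, hR, hh | hh⟩)
      · exact hh
      · simp at hh; exact absurd hh.1 hz
      · simp at hh; exact absurd hh.1 hz
      · simp at hh
      · simp at hh
    · intro hh; exact Or.inl (Or.inl (Or.inl hh))
  have hrelnew : ∀ R ∈ Q, R.interp M (α x) w → IConstraint.rel R x y ∈ S' ∧
      IConstraint.rel R.inverse y x ∈ S' := by
    intro R hR hi
    have : R ∈ ρ := Finset.mem_filter.2 ⟨hR, hi⟩
    exact ⟨(hmem _).2 (Or.inr ⟨R, this, Or.inl rfl⟩), (hmem _).2 (Or.inr ⟨R, this, Or.inr rfl⟩)⟩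
  have hyψ : IConstraint.sat y ψ ∈ S' := (hmem _).2 (Or.inl (Or.inl (Or.inr rfl)))
  set α' := Function.update α y w with hα'
  set lv' := Function.update lv y (lv x + 1) with hlv'
  have ay : α' y = w := by simp [hα']
  have ao : ∀ z, z ≠ y → α' z = α z := fun z hz => by simp [hα', hz]
  have ly : lv' y = lv x + 1 := by simp [hlv']
  have lo : ∀ z, z ≠ y → lv' z = lv z := fun z hz => by simp [hlv', hz]
  refine ⟨⟨S', insert (x, y) st.prec⟩, α', lv', ?_, ?_, ?_⟩
  · refine IStep.ge st S' x ω n ψ y ρ f h hc hng hfresh ?_ hf hcoe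
    intro R hR
    exact Finset.mem_filter.2 ⟨hQ _ _ _ hC hR, hw1 R hR⟩
  · constructor
    · intro z θ hz
      by_cases hzy : z = y
      · subst hzy
        rw [ay, ly]
        rcases (hmem _).1 hz with ((hh | hh) | ⟨θ', σ, m, hm, hh⟩) | ⟨R, hR, hh | hh⟩
        · exact absurd hh (hys _)
        · simp at hh; subst hh
          exact ⟨hw2, (hCl.ge _ _ _ hC).1, by omega⟩
        · simp at hh; subst hh
          have h1 := hxC _ _ _ hm
          have h2 := hfmd θ'
          refine ⟨hfs _, ?_, by omega⟩
          rcases hf θ' with e | e <;> rw [e]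
          · exact h1.1
          · exact h1.2.1
        · simp at hh
        · simp at hh
      · rw [ao z hzy, lo z hzy]
        exact I.sat _ _ ((hsat' z θ hzy).1 hz)
    · intro R a b hr
      rw [hadj]
      rcases (hmem _).1 hr with ((hh | hh) | ⟨θ', σ, m, hm, hh⟩) | ⟨R', hR, hh | hh⟩
      · have := I.rel _ _ _ hh
        rw [ao _ (hadjy _ _ this.1).1, ao _ (hadjy _ _ this.1).2]
        exact ⟨Or.inl this.1, this.2⟩
      · simp at hh
      · simp at hh
      · simp at hh
        obtain ⟨rfl, rfl, rfl⟩ := hh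
        rw [ay, ao _ hxy]
        exact ⟨by simp, (Finset.mem_filter.1 hR).2⟩
      · simp at hh
        obtain ⟨rfl, rfl, rfl⟩ := hh
        rw [ay, ao _ hxy, interp_inverse]
        exact ⟨by simp, (Finset.mem_filter.1 hR).2⟩
    · intro R hR a b hab hi
      rcases (hadj a b).1 hab with hh | ⟨rfl, rfl⟩ | ⟨rfl, rfl⟩
      · rw [ao _ (hadjy _ _ hh).1, ao _ (hadjy _ _ hh).2] at hi
        exact hsub _ (I.maxl R hR _ _ hh hi)
      · rw [ay, ao _ hxy] at hi
        exact (hrelnew R hR hi).1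
      · rw [ay, ao _ hxy, ← interp_inverse] at hi
        have := (hrelnew _ (hQ' R hR) hi).2
        rwa [inverse_inverse] at this
    · intro u a b ha hb hab
      rcases (hadj u a).1 ha with h1 | ⟨rfl, rfl⟩ | ⟨rfl, rfl⟩ <;>
      rcases (hadj u b).1 hb with h2 | ⟨h2, h3⟩ | ⟨h2, h3⟩
      · rw [ao _ (hadjy _ _ h1).2, ao _ (hadjy _ _ h2).2] at hab
        exact I.inj _ _ _ h1 h2 hab
      · subst h2; subst h3
        rw [ao _ (hadjy _ _ h1).2, ay] at hab
        exact absurd hab (hw3 _ h1)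
      · exact absurd h2 (hadjy _ _ h1).1
      · rw [ao _ (hadjy _ _ h2).2, ay] at hab
        exact absurd hab.symm (hw3 _ h2)
      · exact h3.symm
      · exact absurd h2 hxy
      · exact absurd rfl (hadjy _ _ h2).1
      · exact absurd h2.symm hxy
      · exact h3.symm
    · intro a b hab
      rcases Finset.mem_insert.1 hab with hh | hh
      · simp only [Prod.mk.injEq] at hh
        obtain ⟨rfl, rfl⟩ := hh
        rw [ly, lo _ hxy]
      · rw [lo _ (hyP _ _ hh).1, lo _ (hyP _ _ hh).2]
        exact I.lev _ _ hh
    · intro a b hab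
      rcases Finset.mem_insert.1 hab with hh | hh
      · simp only [Prod.mk.injEq] at hh
        obtain ⟨rfl, rfl⟩ := hh
        exact ⟨⟨_, hsub _ h⟩, ⟨_, hyψ⟩⟩
      · obtain ⟨⟨p, hp⟩, ⟨q, hq⟩⟩ := I.node _ _ hh
        exact ⟨⟨p, hsub _ hp⟩, ⟨q, hsub _ hq⟩⟩
  · have hn : ∀ j ≤ lv x, nodes S' lv' j = nodes st.cs lv j := by
      intro j hj
      ext u
      simp only [mem_nodes]
      by_cases hu : u = y
      · subst hu
        rw [ly]
        constructor
        · rintro ⟨h1, -⟩; omega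
        · rintro ⟨-, θ, h1⟩; exact absurd h1 (hys θ)
      · rw [lo _ hu]
        simp only [hsat' u _ hu]
    have hny : ∀ j, ∀ u ∈ nodes st.cs lv j, u ≠ y := by
      rintro j u hu rfl
      obtain ⟨-, θ, h1⟩ := mem_nodes.1 hu
      exact hys θ h1
    have hcM : ∀ j, ∀ u ∈ nodes st.cs lv j, ∀ θ, cM S' u θ = cM st.cs u θ := by
      intro j u hu θ
      simp only [cM, hsat' u θ (hny j u hu)]
    have hgM : ∀ j, ∀ u ∈ nodes st.cs lv j, ∀ θ, gM S' u θ ≤ gM st.cs u θ := by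
      intro j u hu θ
      exact gM_le θ (fun θ => (hsat' u θ (hny j u hu)).1) (fun _ _ _ _ h => hsub _ h)
        (fun _ _ h => hsub _ h)
    refine ⟨lv x, by omega, ?_, ?_⟩
    · intro j hj
      exact mu_le (hn j hj.le) (fun u hu θ => (hcM j u hu θ).le) (hgM j)
    · refine mu_lt_g (hn _ le_rfl) (hcM _) (hgM _) ⟨x, mem_nodes.2 ⟨rfl, _, h⟩, _, hC, ?_⟩
      simp only [gM, h, hsub _ h, if_true]
      have : countI st.cs ω x ψ < countI S' ω x ψ := by
        apply Set.ncard_lt_ncard _ (countI_finite _ _ _ _)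
        refine ⟨fun z hz => ⟨fun R hR => hsub _ (hz.1 R hR), hsub _ hz.2⟩, fun hcon => ?_⟩
        have : y ∈ {y : ℕ | (∀ R ∈ ω.1, IConstraint.rel R x y ∈ S') ∧
            IConstraint.sat y ψ ∈ S'} :=
          ⟨fun R hR => (hrelnew R (hQ _ _ _ hC hR) (hw1 R hR)).1, hyψ⟩
        exact hys _ (hcon this).2
      omega

open Classical in
theorem progress {M : Kripke} {C : Finset GIFormula} {Q : Finset GRel} {D : ℕ} {st : IState}
    {α : ℕ → M.W} {lv : ℕ → ℕ} (I : Inv M C Q D st.cs st.prec α lv) (hCl : Closed C)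
    (hQ : ∀ ω n a, GIFormula.ge ω n a ∈ C → ω.1 ⊆ Q) (hQ' : ∀ R ∈ Q, R.inverse ∈ Q)
    (hnc : ∃ st', IStep st st') :
    ∃ (st' : IState) (α' : ℕ → M.W) (lv' : ℕ → ℕ), IStep st st' ∧
      Inv M C Q D st'.cs st'.prec α' lv' ∧ LexLT D (mu C st'.cs lv') (mu C st.cs lv) := by
  obtain ⟨st', hst⟩ := hnc
  cases hst with
  | and x ψ₁ ψ₂ h h2 =>
    obtain ⟨hs, hC, hmd⟩ := I.sat _ _ h
    simp only [GIFormula.md] at hmd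
    simp only [GIFormula.sat] at hs
    obtain ⟨c1, c2⟩ := hCl.and _ _ hC
    refine ⟨_, α, lv, IStep.and st x ψ₁ ψ₂ h h2, ?_, ?_⟩
    · exact (I.insert hs.2 c2 (by omega)).insert hs.1 c1 (by omega)
    · have hS : ∀ z ψ, IConstraint.sat z ψ ∈ insert (IConstraint.sat x ψ₁)
          (insert (IConstraint.sat x ψ₂) st.cs) → IConstraint.sat z ψ ∈ st.cs ∨ z = x := by
        intro z ψ hz
        simp only [Finset.mem_insert, IConstraint.sat.injEq] at hz
        tauto
      by_cases h1 : IConstraint.sat x ψ₁ ∈ st.cs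
      · exact mu_insert I ⟨_, h⟩ c2 (fun h' => h2 ⟨h1, h'⟩) (by simp)
          (fun c hc => by simp [hc]) hS
      · exact mu_insert I ⟨_, h⟩ c1 h1 (by simp) (fun c hc => by simp [hc]) hS
  | or x ψ₁ ψ₂ _ h h1 h2 _ =>
    obtain ⟨hs, hC, hmd⟩ := I.sat _ _ h
    simp only [GIFormula.md] at hmd
    simp only [GIFormula.sat] at hs
    obtain ⟨c1, c2⟩ := hCl.or _ _ hC
    have : ∃ χ, (χ = ψ₁ ∨ χ = ψ₂) ∧ χ.sat M (α x) := by
      rcases hs with hs | hs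
      · exact ⟨_, Or.inl rfl, hs⟩
      · exact ⟨_, Or.inr rfl, hs⟩
    obtain ⟨χ, hχ, hχs⟩ := this
    have hχC : χ ∈ C ∧ χ.md + lv x ≤ D ∧ IConstraint.sat x χ ∉ st.cs := by
      rcases hχ with rfl | rfl
      · exact ⟨c1, by omega, h1⟩
      · exact ⟨c2, by omega, h2⟩
    refine ⟨_, α, lv, IStep.or st x ψ₁ ψ₂ χ h h1 h2 hχ, I.insert hχs hχC.1 hχC.2.1, ?_⟩
    refine mu_insert I ⟨_, h⟩ hχC.1 hχC.2.2 (by simp) (fun c hc => by simp [hc]) ?_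
    intro z ψ hz
    simp only [Finset.mem_insert, IConstraint.sat.injEq] at hz
    tauto
  | choose _ P' x ω n ψ _ y h hr h1 h2 _ _ hP' =>
    have hψ : ψ ∈ C ∧ ψ.nnfNeg ∈ C ∧ ψ.md + 1 + lv x ≤ D := by
      rcases h with h | h <;> obtain ⟨-, hC, hmd⟩ := I.sat _ _ h
      · exact ⟨(hCl.ge _ _ _ hC).1, (hCl.ge _ _ _ hC).2, hmd⟩
      · exact ⟨(hCl.le _ _ _ hC).1, (hCl.le _ _ _ hC).2, hmd⟩
    obtain ⟨R, hR, hRxy⟩ := hr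
    have hadj := (I.rel _ _ _ hRxy).1
    have hlv := I.adj_lv hadj
    have hnode : ∃ θ, IConstraint.sat y θ ∈ st.cs := by
      rcases hadj with hh | hh
      · exact (I.node _ _ hh).2
      · exact (I.node _ _ hh).1
    have : ∃ χ, (χ = ψ ∨ χ = ψ.nnfNeg) ∧ χ.sat M (α y) := by
      by_cases hs : ψ.sat M (α y)
      · exact ⟨_, Or.inl rfl, hs⟩
      · exact ⟨_, Or.inr rfl, (sat_nnfNeg _ _ _).2 hs⟩
    obtain ⟨χ, hχ, hχs⟩ := this
    have hχC : χ ∈ C ∧ χ.md + lv y ≤ D ∧ IConstraint.sat y χ ∉ st.cs := by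
      have := md_nnfNeg ψ
      rcases hχ with rfl | rfl
      · exact ⟨hψ.1, by omega, h1⟩
      · exact ⟨hψ.2.1, by omega, h2⟩
    have hlow : ∀ z, lv z ≤ lv y → ¬ Relation.TransGen (precRel st.prec) y z := by
      intro z hz ht
      have := I.desc_lv ht
      omega
    refine ⟨⟨insert (IConstraint.sat y χ) (st.cs.filter fun c => ∀ z ∈ c.vars,
      ¬ Relation.TransGen (precRel st.prec) y z), P'⟩, α, lv,
      IStep.choose st _ P' x ω n ψ χ y h ⟨R, hR, hRxy⟩ h1 h2 hχ ?_ hP', 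
      (I.prune y hP').insert hχs hχC.1 hχC.2.1, ?_⟩
    · ext c
      simp only [Finset.coe_insert, Finset.coe_filter, Set.mem_insert_iff, Set.mem_setOf_eq,
        Set.mem_union, Set.mem_singleton_iff]
      tauto
    · have hback : ∀ u θ, IConstraint.sat u θ ∈ insert (IConstraint.sat y χ)
          (st.cs.filter fun c => ∀ z ∈ c.vars, ¬ Relation.TransGen (precRel st.prec) y z) →
          IConstraint.sat u θ ∈ st.cs ∨ u = y := by
        intro u θ hu
        simp only [Finset.mem_insert, Finset.mem_filter, IConstraint.sat.injEq] at hu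
        tauto
      apply mu_nongen (k := lv y) (by omega)
      · intro u θ hu hs
        refine Finset.mem_insert_of_mem (Finset.mem_filter.2 ⟨hs, ?_⟩)
        simp [IConstraint.vars, hlow u hu]
      · intro u θ hu hs
        rcases hback _ _ hs with hh | rfl
        · exact hh
        · omega
      · intro R u v hu hv hs
        refine Finset.mem_insert_of_mem (Finset.mem_filter.2 ⟨hs, ?_⟩)
        simp [IConstraint.vars, hlow u hu, hlow v hv]
      · intro u θ hu hs
        rcases hback _ _ hs with hh | rfl
        · exact ⟨_, hh⟩
        · exact hnode
      · exact ⟨y, rfl, hnode, χ, hχC.1, hχC.2.2, Finset.mem_insert_self _ _⟩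
      · exact fun R u v hh => I.adj_lv (I.rel _ _ _ hh).1
  | ge S' x ω n ψ y ρ f h hc hng hfresh hρ hf hS' =>
    exact gen_step I hCl hQ hQ' h hc hng hfresh

theorem run {M : Kripke} {C : Finset GIFormula} {Q : Finset GRel} {D : ℕ} (hCl : Closed C)
    (hQ : ∀ ω n a, GIFormula.ge ω n a ∈ C → ω.1 ⊆ Q) (hQ' : ∀ R ∈ Q, R.inverse ∈ Q)
    (m : ℕ → ℕ ×ₗ ℕ) : ∀ (st : IState) (α : ℕ → M.W) (lv : ℕ → ℕ),
      Inv M C Q D st.cs st.prec α lv → mu C st.cs lv = m →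
      ∃ st', Relation.ReflTransGen IStep st st' ∧ ICompleteState st' ∧ ¬ hasClashI st'.cs := by
  induction m using (lexLT_wf D).induction with
  | _ m ih =>
    intro st α lv I hm
    by_cases hcomp : ICompleteState st
    · exact ⟨st, Relation.ReflTransGen.refl, hcomp, I.not_clash⟩
    · obtain ⟨st₁, α₁, lv₁, hstep, I₁, hlt⟩ := progress I hCl hQ hQ' (not_not.1 hcomp)
      subst hm
      obtain ⟨st₂, h2, h3, h4⟩ := ih _ hlt st₁ α₁ lv₁ I₁ rfl
      exact ⟨st₂, Relation.ReflTransGen.head hstep h2, h3, h4⟩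

end GrK

open GrK in
/-- completeness of the Gr(K_{R⁻¹∩})-algorithm: if φ (in NNF) is
satisfiable, then some sequence of applications of the Gr(K_{R⁻¹∩}) rules
starting from ({x₀ ⊨ φ}, ∅) yields a complete and clash-free constraint
system. -/
theorem stmt_18 (φ : GIFormula) (hNNF : φ.isNNF) (hsat : φ.satisfiable) (x₀ : ℕ) :
    ∃ st, IReach x₀ φ st ∧ ICompleteState st ∧ ¬ hasClashI st.cs := by
  obtain ⟨M, w, hw⟩ := hsat
  obtain ⟨C, hφ, hCl⟩ := exists_closed φ
  obtain ⟨Q, hQ, hQ'⟩ := exists_rels C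
  refine run (M := M) (D := φ.md) hCl hQ hQ' _ (initI x₀ φ) (fun _ => w) (fun _ => 0) ?_ rfl
  constructor
  · intro x ψ h
    simp only [initI, Finset.mem_singleton, IConstraint.sat.injEq] at h
    obtain ⟨rfl, rfl⟩ := h
    exact ⟨hw, hφ, le_rfl⟩
  · intro R x y h
    simp [initI] at h
  · intro R hR x y h
    simp [initI, adjP] at h
  · intro x y z h
    simp [initI, adjP] at h
  · intro x y h
    simp [initI] at h
  · intro x y h
    simp [initI] at h
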